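/- arXiv:1204.0879 — 8 statements merged into one kernel-verified Lean document; each statement's English description precedes it below -/
import Mathlib

section
/- For all real numbers a, b with a² + b² < 1, writing β = √(1 − a² − b²), one has (1/π)·∫₀^{2π} cos²(t) / (1 + a·cos(t) + b·sin(t)) dt = (1/β)·(1 + (a² − b²)/(1 + β)²). -/
open Real

/-- An affine trigonometric function `1 + a cos t + b sin t` with `a² + b² < 1` is positive. -/
lemma one_add_mul_cos_add_mul_sin_pos {a b : ℝ} (h : a ^ 2 + b ^ 2 < 1) (t : ℝ) :
    0 < 1 + a * cos t + b * sin t := by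
  have h1 : (a * cos t + b * sin t) ^ 2 < 1 := by
    nlinarith [sq_nonneg (a * sin t - b * cos t), sin_sq_add_cos_sq t]
  nlinarith [(abs_lt.mp ((sq_lt_one_iff_abs_lt_one _).mp h1)).1]

/-- A globally smooth primitive of `β / (1 + a cos t + b sin t)`, where `β² = 1 - a² - b²`. -/
lemma hasDerivAt_sub_two_mul_arctan {a b β : ℝ} (h : a ^ 2 + b ^ 2 < 1) (hβ : 0 < β)
    (hβ2 : β ^ 2 = 1 - a ^ 2 - b ^ 2) (t : ℝ) :
    HasDerivAt
      (fun t => t - 2 * arctan ((a * sin t - b * cos t) / (1 + β + a * cos t + b * sin t)))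
      (β / (1 + a * cos t + b * sin t)) t := by
  have hD := one_add_mul_cos_add_mul_sin_pos h t
  have hE : 0 < 1 + β + a * cos t + b * sin t := by linarith
  have hn : HasDerivAt (fun t => a * sin t - b * cos t) (a * cos t - b * -sin t) t :=
    ((hasDerivAt_sin t).const_mul a).sub ((hasDerivAt_cos t).const_mul b)
  have hd : HasDerivAt (fun t => 1 + β + a * cos t + b * sin t)
      (a * -sin t + b * cos t) t :=
    (((hasDerivAt_cos t).const_mul a).const_add (1 + β)).add ((hasDerivAt_sin t).const_mul b)
  refine ((hasDerivAt_id t).sub (((hn.div hd hE.ne').arctan).const_mul 2)).congr_deriv ?_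
  have key : (1 + β + a * cos t + b * sin t) ^ 2 + (a * sin t - b * cos t) ^ 2
      = 2 * (1 + β) * (1 + a * cos t + b * sin t) := by
    linear_combination (a ^ 2 + b ^ 2) * sin_sq_add_cos_sq t + hβ2
  have hsum : 1 + ((a * sin t - b * cos t) / (1 + β + a * cos t + b * sin t)) ^ 2
      = 2 * (1 + β) * (1 + a * cos t + b * sin t) / (1 + β + a * cos t + b * sin t) ^ 2 := by
    rw [← key, div_pow, add_div, div_self (pow_ne_zero 2 hE.ne')]
  have hβ1 : (1 + β) ≠ 0 := by positivity
  simp only [Pi.div_apply]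
  rw [hsum]
  generalize hEe : 1 + β + a * cos t + b * sin t = E at *
  generalize hDe : 1 + a * cos t + b * sin t = D at *
  have hE0 := hE.ne'
  have hD0 := hD.ne'
  field_simp
  subst hEe hDe
  linear_combination (-(a ^ 2 + b ^ 2)) * sin_sq_add_cos_sq t - hβ2

/-- A primitive of `cos² t / (1 + a cos t + b sin t)`, up to the factor `(a² + b²)²`. -/
lemma hasDerivAt_primitive_cos_sq_div {a b β : ℝ} (h : a ^ 2 + b ^ 2 < 1) (hβ : 0 < β)
    {A : ℝ → ℝ} {t : ℝ} (hA : HasDerivAt A (β / (1 + a * cos t + b * sin t)) t) :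
    HasDerivAt
      (fun t => (a ^ 2 - b ^ 2) * (a * sin t - b * cos t - t)
        + 2 * a * b * (a * cos t + b * sin t - log (1 + a * cos t + b * sin t))
        + (a ^ 2 - b ^ 2 + b ^ 2 * (a ^ 2 + b ^ 2)) / β * A t)
      ((a ^ 2 + b ^ 2) ^ 2 * (cos t ^ 2 / (1 + a * cos t + b * sin t))) t := by
  have hD := (one_add_mul_cos_add_mul_sin_pos h t).ne'
  have hn : HasDerivAt (fun t => a * sin t - b * cos t - t) (a * cos t - b * -sin t - 1) t :=
    (((hasDerivAt_sin t).const_mul a).sub ((hasDerivAt_cos t).const_mul b)).sub (hasDerivAt_id t)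
  have hu : HasDerivAt (fun t => a * cos t + b * sin t) (a * -sin t + b * cos t) t :=
    ((hasDerivAt_cos t).const_mul a).add ((hasDerivAt_sin t).const_mul b)
  have hd : HasDerivAt (fun t => 1 + a * cos t + b * sin t) (a * -sin t + b * cos t) t :=
    (((hasDerivAt_cos t).const_mul a).const_add 1).add ((hasDerivAt_sin t).const_mul b)
  refine (((hn.const_mul _).add ((hu.sub (hd.log hD)).const_mul (2 * a * b))).add
    (hA.const_mul _)).congr_deriv ?_
  generalize hDe : 1 + a * cos t + b * sin t = D at *
  field_simp
  subst hDe
  have hs : sin t ^ 2 = 1 - cos t ^ 2 := sin_sq t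
  ring_nf
  simp only [hs]
  ring

/-- Proposition 3.1 (σ₁₁ entry): for `a² + b² < 1`, writing `β = √(1 − a² − b²)`,
`(1/π)·∫₀^{2π} cos²t / (1 + a·cos t + b·sin t) dt = (1/β)·(1 + (a² − b²)/(1 + β)²)`. -/
theorem randers_symbol_sigma11 (a b : ℝ) (h : a ^ 2 + b ^ 2 < 1) :
    (1 / π) * ∫ t in (0 : ℝ)..(2 * π),
        Real.cos t ^ 2 / (1 + a * Real.cos t + b * Real.sin t) =
      (1 / Real.sqrt (1 - a ^ 2 - b ^ 2)) *
        (1 + (a ^ 2 - b ^ 2) / (1 + Real.sqrt (1 - a ^ 2 - b ^ 2)) ^ 2) := by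
  have hβ : 0 < √(1 - a ^ 2 - b ^ 2) := sqrt_pos.mpr (by linarith)
  have hβ2 : √(1 - a ^ 2 - b ^ 2) ^ 2 = 1 - a ^ 2 - b ^ 2 := sq_sqrt (by linarith)
  generalize √(1 - a ^ 2 - b ^ 2) = β at *
  have hπ := pi_ne_zero
  rcases eq_or_ne (a ^ 2 + b ^ 2) 0 with h0 | h0
  · have ha : a = 0 := by nlinarith [sq_nonneg a, sq_nonneg b]
    have hb : b = 0 := by nlinarith [sq_nonneg a, sq_nonneg b]
    subst ha hb
    have hβ1 : β = 1 := by nlinarith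
    subst hβ1
    simp [integral_cos_sq]
  · have hcont : Continuous fun t : ℝ =>
        (a ^ 2 + b ^ 2) ^ 2 * (cos t ^ 2 / (1 + a * cos t + b * sin t)) :=
      continuous_const.mul ((by fun_prop : Continuous fun t => cos t ^ 2).div (by fun_prop)
        fun t => (one_add_mul_cos_add_mul_sin_pos h t).ne')
    have hint := intervalIntegral.integral_eq_sub_of_hasDerivAt
      (fun t _ => hasDerivAt_primitive_cos_sq_div h hβ (hasDerivAt_sub_two_mul_arctan h hβ hβ2 t))
      (hcont.intervalIntegrable 0 (2 * π))
    rw [intervalIntegral.integral_const_mul] at hint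
    simp only [cos_two_pi, sin_two_pi, cos_zero, sin_zero] at hint
    generalize (∫ t in (0 : ℝ)..(2 * π), cos t ^ 2 / (1 + a * cos t + b * sin t)) = I at *
    have hI : (a ^ 2 + b ^ 2) ^ 2 * I =
        2 * π * ((a ^ 2 - b ^ 2 + b ^ 2 * (a ^ 2 + b ^ 2)) / β - (a ^ 2 - b ^ 2)) := by
      rw [hint]; ring
    have hr : a ^ 2 = 1 - β ^ 2 - b ^ 2 := by linarith
    have hβ1 : 1 + β ≠ 0 := by positivity
    refine mul_left_cancel₀ (pow_ne_zero 2 h0) ?_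
    rw [mul_left_comm, hI]
    field_simp
    rw [hr]
    ring
end

section
/- For all real numbers a, b with a² + b² < 1, writing β = √(1 − a² − b²), one has (1/π)·∫₀^{2π} sin²(t) / (1 + a·cos(t) + b·sin(t)) dt = (1/β)·(1 − (a² − b²)/(1 + β)²). -/
open Real

/-- The Poisson kernel of the unit disc at `w = -(a + b i) / (1 + β)`, evaluated on the unit
circle. -/
lemma poissonKernel_unit_circleMap {a b β : ℝ} (hβ : 0 < β) (hsq : β ^ 2 = 1 - a ^ 2 - b ^ 2)
    (t : ℝ) :
    poissonKernel 0 ⟨-a / (1 + β), -b / (1 + β)⟩ (circleMap 0 1 t) =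
      β / (1 + a * cos t + b * sin t) := by
  have hre : (circleMap 0 1 t).re = cos t := by
    simp [circleMap, Complex.exp_ofReal_mul_I_re]
  have him : (circleMap 0 1 t).im = sin t := by
    simp [circleMap, Complex.exp_ofReal_mul_I_im]
  have hcs := sin_sq_add_cos_sq t
  have hβ1 : 1 + β ≠ 0 := by positivity
  have hden : 0 < 1 + a * cos t + b * sin t := by
    nlinarith [sq_nonneg (a * sin t - b * cos t), sq_pos_of_pos hβ,
      sq_nonneg (a * cos t + b * sin t)]
  have hnum : 1 - ((-a / (1 + β)) ^ 2 + (-b / (1 + β)) ^ 2) = 2 * β / (1 + β) := by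
    field_simp
    linear_combination -hsq
  have hdist : (cos t - -a / (1 + β)) ^ 2 + (sin t - -b / (1 + β)) ^ 2 =
      2 * (1 + a * cos t + b * sin t) / (1 + β) := by
    field_simp
    linear_combination (1 + β) ^ 2 * hcs + hsq
  have hnormSq : ∀ z : ℂ, ‖z‖ ^ 2 = z.re ^ 2 + z.im ^ 2 := fun z ↦ by
    rw [← Complex.normSq_eq_norm_sq, Complex.normSq_apply]; ring
  simp only [poissonKernel_def, sub_zero, hnormSq, Complex.sub_re, Complex.sub_im, hre, him]
  rw [hdist, add_comm (cos t ^ 2), hcs, hnum]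
  field_simp

/-- Proposition 3.1 (σ₂₂ entry): for `a² + b² < 1`, writing `β = √(1 − a² − b²)`,
`(1/π)·∫₀^{2π} sin²t / (1 + a·cos t + b·sin t) dt = (1/β)·(1 − (a² − b²)/(1 + β)²)`. -/
theorem randers_symbol_sigma22 (a b : ℝ) (h : a ^ 2 + b ^ 2 < 1) :
    (1 / π) * ∫ t in (0 : ℝ)..(2 * π),
        Real.sin t ^ 2 / (1 + a * Real.cos t + b * Real.sin t) =
      (1 / Real.sqrt (1 - a ^ 2 - b ^ 2)) *
        (1 - (a ^ 2 - b ^ 2) / (1 + Real.sqrt (1 - a ^ 2 - b ^ 2)) ^ 2) := by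
  have hβ : 0 < √(1 - a ^ 2 - b ^ 2) := sqrt_pos.mpr (by linarith)
  have hsq : √(1 - a ^ 2 - b ^ 2) ^ 2 = 1 - a ^ 2 - b ^ 2 := sq_sqrt (by linarith)
  set β := √(1 - a ^ 2 - b ^ 2)
  have hw : (⟨-a / (1 + β), -b / (1 + β)⟩ : ℂ) ∈ Metric.ball (0 : ℂ) 1 := by
    rw [mem_ball_zero_iff, ← sq_lt_one_iff₀ (norm_nonneg _), ← Complex.normSq_eq_norm_sq,
      Complex.normSq_mk, div_mul_div_comm, div_mul_div_comm, ← add_div, div_lt_one (by positivity)]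
    nlinarith
  have hharm : InnerProductSpace.HarmonicOnNhd (fun z : ℂ ↦ (1 - z ^ 2).re)
      (Metric.closedBall 0 1) := fun z _ ↦
    AnalyticAt.harmonicAt_re (f := fun z : ℂ ↦ 1 - z ^ 2) (by fun_prop)
  have hpoisson := hharm.circleAverage_poissonKernel_smul hw
  have hintegrand : ∀ t : ℝ, (poissonKernel 0 ⟨-a / (1 + β), -b / (1 + β)⟩ •
      fun z : ℂ ↦ (1 - z ^ 2).re) (circleMap 0 1 t) =
      2 * β * (sin t ^ 2 / (1 + a * cos t + b * sin t)) := fun t ↦ by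
    have hre : (1 - circleMap 0 1 t ^ 2).re = 2 * sin t ^ 2 := by
      simp [circleMap, pow_two, Complex.exp_ofReal_mul_I_re, Complex.exp_ofReal_mul_I_im]
      linear_combination - sin_sq_add_cos_sq t
    rw [Pi.smul_apply', poissonKernel_unit_circleMap hβ hsq, hre, smul_eq_mul]
    ring
  simp only [circleAverage_def, hintegrand, intervalIntegral.integral_const_mul] at hpoisson
  rw [smul_eq_mul] at hpoisson
  have hval : (1 - (⟨-a / (1 + β), -b / (1 + β)⟩ : ℂ) ^ 2).re =
      1 - (a ^ 2 - b ^ 2) / (1 + β) ^ 2 := by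
    simp only [pow_two, Complex.sub_re, Complex.one_re, Complex.mul_re]
    field_simp
  rw [← hval, ← hpoisson]
  generalize (∫ t in (0 : ℝ)..(2 * π), sin t ^ 2 / (1 + a * cos t + b * sin t)) = I
  field_simp
end

section
/- For all real numbers a, b with a² + b² < 1, writing β = √(1 − a² − b²), set S₁₁ = (1/π)∫₀^{2π} cos²t/(1 + a cos t + b sin t) dt, S₂₂ = (1/π)∫₀^{2π} sin²t/(1 + a cos t + b sin t) dt, and S₁₂ = (1/π)∫₀^{2π} cos t·sin t/(1 + a cos t + b sin t) dt. Then S₁₁·S₂₂ − S₁₂² = 4/(β·(1 + β)²). -/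
open Real

/-- The Randers function `1 + a cos t + b sin t` is positive when `a² + b² < 1`. -/
lemma randers_pos {a b : ℝ} (h : a ^ 2 + b ^ 2 < 1) (t : ℝ) :
    0 < 1 + a * Real.cos t + b * Real.sin t := by
  have h1 := Real.sin_sq_add_cos_sq t
  nlinarith [sq_nonneg (a + Real.cos t), sq_nonneg (b + Real.sin t)]

lemma continuous_div_randers {a b : ℝ} (h : a ^ 2 + b ^ 2 < 1) {f : ℝ → ℝ}
    (hf : Continuous f) :
    Continuous fun t => f t / (1 + a * Real.cos t + b * Real.sin t) :=
  hf.div (by fun_prop) fun t => (randers_pos h t).ne'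

lemma intervalIntegrable_div_randers {a b : ℝ} (h : a ^ 2 + b ^ 2 < 1) {f : ℝ → ℝ}
    (hf : Continuous f) (u v : ℝ) :
    IntervalIntegrable (fun t => f t / (1 + a * Real.cos t + b * Real.sin t))
      MeasureTheory.volume u v :=
  (continuous_div_randers h hf).intervalIntegrable u v

/-- A global antiderivative of `β / (1 + a cos t + b sin t)`, with `β = √(1 - a² - b²)`. -/
lemma hasDerivAt_randers_primitive {a b β : ℝ} (h : a ^ 2 + b ^ 2 < 1) (hβ : 0 < β)
    (hβ2 : β ^ 2 = 1 - a ^ 2 - b ^ 2) (t : ℝ) :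
    HasDerivAt
      (fun t => t - 2 * Real.arctan ((a * Real.sin t - b * Real.cos t) /
        (β + (1 + a * Real.cos t + b * Real.sin t))))
      (β * (1 / (1 + a * Real.cos t + b * Real.sin t))) t := by
  have hD := randers_pos h t
  have hE : β + (1 + a * Real.cos t + b * Real.sin t) ≠ 0 := by positivity
  have hnum : HasDerivAt (fun t => a * Real.sin t - b * Real.cos t)
      (a * Real.cos t - b * -Real.sin t) t :=
    ((Real.hasDerivAt_sin t).const_mul a).sub ((Real.hasDerivAt_cos t).const_mul b)
  have hden : HasDerivAt (fun t => β + (1 + a * Real.cos t + b * Real.sin t))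
      (a * -Real.sin t + b * Real.cos t) t :=
    ((((Real.hasDerivAt_cos t).const_mul a).const_add 1).add
      ((Real.hasDerivAt_sin t).const_mul b)).const_add β
  have hmain := (hasDerivAt_id t).sub (((hnum.div hden hE).arctan).const_mul 2)
  refine hmain.congr_deriv ?_
  simp only [Pi.div_apply]
  clear hmain hnum hden
  have h1 := Real.sin_sq_add_cos_sq t
  generalize Real.sin t = s at *
  generalize Real.cos t = c at *
  obtain ⟨D, hDe⟩ : ∃ D, D = 1 + a * c + b * s := ⟨_, rfl⟩
  rw [← hDe] at hD hE ⊢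
  have hsq : (a * s - b * c) ^ 2 = 1 - β ^ 2 - (D - 1) ^ 2 := by
    rw [hDe, hβ2]
    linear_combination (a ^ 2 + b ^ 2) * h1
  have hcos : a * c - b * -s = D - 1 := by rw [hDe]; ring
  have hsin : a * -s + b * c = -(a * s - b * c) := by ring
  rw [hcos, hsin]
  generalize a * s - b * c = N at *
  have hsum : 1 + (N / (β + D)) ^ 2 = 2 * D * (1 + β) / (β + D) ^ 2 := by
    field_simp
    linear_combination hsq
  rw [hsum]
  field_simp
  linear_combination (-1 : ℝ) * hsq

lemma integral_one_div_randers {a b β : ℝ} (h : a ^ 2 + b ^ 2 < 1) (hβ : 0 < β)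
    (hβ2 : β ^ 2 = 1 - a ^ 2 - b ^ 2) :
    β * ∫ t in (0 : ℝ)..(2 * π), 1 / (1 + a * Real.cos t + b * Real.sin t) = 2 * π := by
  rw [← intervalIntegral.integral_const_mul,
    intervalIntegral.integral_eq_sub_of_hasDerivAt
      (fun t _ => hasDerivAt_randers_primitive h hβ hβ2 t)
      ((intervalIntegrable_div_randers h continuous_const _ _).const_mul β)]
  simp

/-- The logarithmic derivative of the Randers function has zero mean. -/
lemma integral_logDeriv_randers {a b : ℝ} (h : a ^ 2 + b ^ 2 < 1) :
    ∫ t in (0 : ℝ)..(2 * π), (b * Real.cos t - a * Real.sin t) /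
      (1 + a * Real.cos t + b * Real.sin t) = 0 := by
  have hderiv (t : ℝ) : HasDerivAt (fun t => Real.log (1 + a * Real.cos t + b * Real.sin t))
      ((b * Real.cos t - a * Real.sin t) / (1 + a * Real.cos t + b * Real.sin t)) t := by
    have hd : HasDerivAt (fun t => 1 + a * Real.cos t + b * Real.sin t)
        (a * -Real.sin t + b * Real.cos t) t :=
      (((Real.hasDerivAt_cos t).const_mul a).const_add 1).add
        ((Real.hasDerivAt_sin t).const_mul b)
    refine (hd.log (randers_pos h t).ne').congr_deriv ?_
    ring
  rw [intervalIntegral.integral_eq_sub_of_hasDerivAt (fun t _ => hderiv t)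
    (intervalIntegrable_div_randers h (by fun_prop) _ _)]
  simp

/-- Integration against `1 / (1 + a cos t + b sin t)` is linear. -/
lemma integral_comb_div_randers {a b : ℝ} (h : a ^ 2 + b ^ 2 < 1) {f g k : ℝ → ℝ}
    (hf : Continuous f) (hg : Continuous g) (hk : Continuous k) (p q r u v : ℝ) :
    ∫ t in u..v, (p * f t + q * g t + r * k t) / (1 + a * Real.cos t + b * Real.sin t) =
      p * (∫ t in u..v, f t / (1 + a * Real.cos t + b * Real.sin t)) +
      q * (∫ t in u..v, g t / (1 + a * Real.cos t + b * Real.sin t)) +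
      r * ∫ t in u..v, k t / (1 + a * Real.cos t + b * Real.sin t) := by
  have If := (intervalIntegrable_div_randers h hf u v).const_mul p
  have Ig := (intervalIntegrable_div_randers h hg u v).const_mul q
  have Ik := (intervalIntegrable_div_randers h hk u v).const_mul r
  simp only [← intervalIntegral.integral_const_mul]
  rw [← intervalIntegral.integral_add If Ig, ← intervalIntegral.integral_add (If.add Ig) Ik]
  congr 1 with t
  ring

/-- Multiplying the integrand by the Randers function cancels the denominator. -/
lemma integral_mul_randers_div {a b : ℝ} (h : a ^ 2 + b ^ 2 < 1) {f : ℝ → ℝ}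
    (hf : Continuous f) (u v : ℝ) :
    (∫ t in u..v, f t / (1 + a * Real.cos t + b * Real.sin t)) +
      a * (∫ t in u..v, f t * Real.cos t / (1 + a * Real.cos t + b * Real.sin t)) +
      b * (∫ t in u..v, f t * Real.sin t / (1 + a * Real.cos t + b * Real.sin t)) =
      ∫ t in u..v, f t := by
  have hcomb := integral_comb_div_randers h hf (hf.mul Real.continuous_cos)
    (hf.mul Real.continuous_sin) 1 a b u v
  simp only [one_mul, Pi.mul_apply] at hcomb
  rw [← hcomb]
  congr 1 with t
  rw [div_eq_iff (randers_pos h t).ne']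
  ring

/-- A symmetric matrix with trace `T` and eigenvector `(a, b) ≠ 0` of eigenvalue `-K` has
determinant `-K (T + K)`. -/
lemma det_of_eigenvector {a b x y z K T : ℝ} (hab : a ^ 2 + b ^ 2 ≠ 0)
    (hx : a * x + b * y = -(a * K)) (hz : a * y + b * z = -(b * K)) (hT : x + z = T) :
    x * z - y ^ 2 = -K * (T + K) := by
  subst hT
  refine mul_left_cancel₀ hab ?_
  linear_combination (a * (z + K) - b * y) * hx + (b * (x + K) - a * y) * hz

/-- Corollary (determinant of the symbol of the Finsler–Laplace operator of a Randers
surface metric): for `a² + b² < 1`, writing `β = √(1 − a² − b²)`, the matrix of moments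
`Sᵢⱼ` of the Randers angle satisfies `S₁₁·S₂₂ − S₁₂² = 4/(β·(1 + β)²)`. -/
theorem randers_symbol_det (a b : ℝ) (h : a ^ 2 + b ^ 2 < 1) (S11 S22 S12 : ℝ)
    (h11 : S11 = (1 / π) * ∫ t in (0 : ℝ)..(2 * π),
        Real.cos t ^ 2 / (1 + a * Real.cos t + b * Real.sin t))
    (h22 : S22 = (1 / π) * ∫ t in (0 : ℝ)..(2 * π),
        Real.sin t ^ 2 / (1 + a * Real.cos t + b * Real.sin t))
    (h12 : S12 = (1 / π) * ∫ t in (0 : ℝ)..(2 * π),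
        Real.cos t * Real.sin t / (1 + a * Real.cos t + b * Real.sin t)) :
    S11 * S22 - S12 ^ 2 =
      4 / (Real.sqrt (1 - a ^ 2 - b ^ 2) * (1 + Real.sqrt (1 - a ^ 2 - b ^ 2)) ^ 2) := by
  have hβ : 0 < √(1 - a ^ 2 - b ^ 2) := Real.sqrt_pos.2 (by linarith)
  have hβ2 : √(1 - a ^ 2 - b ^ 2) ^ 2 = 1 - a ^ 2 - b ^ 2 := Real.sq_sqrt (by linarith)
  generalize √(1 - a ^ 2 - b ^ 2) = β at *
  have hJ0 := integral_one_div_randers h hβ hβ2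
  have hlog := integral_logDeriv_randers h
  have hlogc := integral_comb_div_randers h Real.continuous_cos Real.continuous_sin
    continuous_const (k := fun _ => 1) b (-a) 0 0 (2 * π)
  have htr := integral_comb_div_randers h (Real.continuous_cos.pow 2)
    (Real.continuous_sin.pow 2) continuous_const (k := fun _ => 1) 1 1 0 0 (2 * π)
  have h1 := integral_mul_randers_div h continuous_const (f := fun _ => 1) 0 (2 * π)
  have hc := integral_mul_randers_div h Real.continuous_cos 0 (2 * π)
  have hs := integral_mul_randers_div h Real.continuous_sin 0 (2 * π)
  simp only [zero_mul, add_zero, one_mul, neg_mul, ← sub_eq_add_neg, Pi.pow_apply,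
    Real.cos_sq_add_sin_sq, hlog] at hlogc htr h1
  simp only [← sq, integral_cos, integral_sin, Real.sin_two_pi, Real.cos_two_pi, Real.sin_zero,
    Real.cos_zero, sub_self, intervalIntegral.integral_const, sub_zero, smul_eq_mul, mul_one,
    mul_comm (Real.sin _) (Real.cos _)] at h1 hc hs
  by_cases hab : a ^ 2 + b ^ 2 = 0
  · obtain rfl : a = 0 := by nlinarith [sq_nonneg a, sq_nonneg b]
    obtain rfl : b = 0 := by nlinarith [sq_nonneg b]
    obtain rfl : β = 1 := by nlinarith
    simp [integral_cos_sq, integral_sin_sq, integral_sin_mul_cos₁,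
      mul_comm (Real.cos _)] at h11 h22 h12
    subst h11 h22 h12
    field_simp
    norm_num
  rw [h11, h22, h12]
  generalize (∫ t in (0 : ℝ)..(2 * π), Real.cos t ^ 2 / _) = x at *
  generalize (∫ t in (0 : ℝ)..(2 * π), Real.sin t ^ 2 / _) = z at *
  generalize (∫ t in (0 : ℝ)..(2 * π), Real.cos t * Real.sin t / _) = y at *
  generalize (∫ t in (0 : ℝ)..(2 * π), Real.cos t / _) = C at *
  generalize (∫ t in (0 : ℝ)..(2 * π), Real.sin t / _) = S at *
  generalize (∫ t in (0 : ℝ)..(2 * π), (1 : ℝ) / _) = J at *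
  obtain rfl : J = 2 * π / β := by rw [eq_div_iff hβ.ne', ← hJ0]; ring
  have hK : (a ^ 2 + b ^ 2) * (-(2 * π) / (β * (1 + β))) = 2 * π - 2 * π / β := by
    rw [show a ^ 2 + b ^ 2 = 1 - β ^ 2 by linarith]
    field_simp
    ring
  have hC : C = a * (-(2 * π) / (β * (1 + β))) := by
    refine mul_left_cancel₀ hab ?_
    linear_combination a * h1 - b * hlogc - a * hK
  have hS : S = b * (-(2 * π) / (β * (1 + β))) := by
    refine mul_left_cancel₀ hab ?_
    linear_combination b * h1 + a * hlogc - b * hK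
  have hdet := det_of_eigenvector hab (x := x) (y := y) (z := z)
    (K := -(2 * π) / (β * (1 + β)))
    (by linear_combination hc - hC) (by linear_combination hs - hS) htr.symm
  have hπ := Real.pi_ne_zero
  calc 1 / π * x * (1 / π * z) - (1 / π * y) ^ 2 = (x * z - y ^ 2) / π ^ 2 := by ring
    _ = 4 / (β * (1 + β) ^ 2) := by
      rw [hdet]
      field_simp
      ring
end

section
/- Let E be a real inner product space, V ∈ E, and ε ∈ ℝ with |ε|·‖V‖ < 1. Then for every ξ ∈ E, sup{ ⟨p, ξ⟩ : p ∈ E, ‖p‖ + ε·⟨p, V⟩ = 1 } = ( √( ‖ξ‖²·(1 − ε²‖V‖²) + ε²·⟨V, ξ⟩² ) − ε·⟨V, ξ⟩ ) / (1 − ε²‖V‖²). -/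
open scoped RealInnerProductSpace

/-- If `‖ξ - F • W‖ = F` and `‖W‖ < 1`, then `F` is the value at `ξ` of the dual of the
co-norm `p ↦ ‖p‖ + ⟪p, W⟫`. -/
theorem sSup_inner_eq_of_norm_sub_smul_eq {E : Type*} [NormedAddCommGroup E]
    [InnerProductSpace ℝ E] {W ξ : E} {F : ℝ} (hW : ‖W‖ < 1) (hF : ‖ξ - F • W‖ = F) :
    sSup {x : ℝ | ∃ p : E, ‖p‖ + ⟪p, W⟫ = 1 ∧ x = ⟪p, ξ⟫} = F := by
  have hF0 : 0 ≤ F := hF ▸ norm_nonneg _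
  rcases hF0.eq_or_lt with rfl | hpos
  · have hξ : ξ = 0 := by simpa using hF
    subst hξ
    refine le_antisymm (Real.sSup_nonpos ?_) (Real.sSup_nonneg ?_) <;>
      · rintro x ⟨p, -, rfl⟩
        simp
  obtain ⟨q, hq⟩ : ∃ q, q = ξ - F • W := ⟨_, rfl⟩
  have hξ : ξ = q + F • W := by simp [hq]
  rw [← hq] at hF
  refine IsGreatest.csSup_eq ⟨?_, ?_⟩
  · have hH : 0 < F + ⟪q, W⟫ := by
      have h1 := neg_le_of_abs_le (abs_real_inner_le_norm q W)
      rw [hF] at h1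
      nlinarith
    refine ⟨(F + ⟪q, W⟫)⁻¹ • q, ?_, ?_⟩
    · rw [norm_smul, Real.norm_of_nonneg (inv_nonneg.2 hH.le), real_inner_smul_left, hF]
      field_simp
    · rw [hξ, real_inner_smul_left, inner_add_right, real_inner_smul_right,
        real_inner_self_eq_norm_sq, hF]
      field_simp
  · rintro x ⟨p, hp, rfl⟩
    have h1 := real_inner_le_norm p q
    rw [hF] at h1
    rw [hξ, inner_add_right, real_inner_smul_right]
    linear_combination h1 + F * hp

/-- The explicit Randers-type expression solves the equation `‖ξ - F • W‖ = F`. -/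
theorem norm_sub_smul_eq_of_norm_lt_one {E : Type*} [NormedAddCommGroup E]
    [InnerProductSpace ℝ E] {W : E} (hW : ‖W‖ < 1) (ξ : E) {F : ℝ}
    (hF : F = (Real.sqrt (‖ξ‖ ^ 2 * (1 - ‖W‖ ^ 2) + ⟪W, ξ⟫ ^ 2) - ⟪W, ξ⟫) / (1 - ‖W‖ ^ 2)) :
    ‖ξ - F • W‖ = F := by
  have hd : 0 < 1 - ‖W‖ ^ 2 := by nlinarith [norm_nonneg W]
  have hle : ⟪W, ξ⟫ ^ 2 ≤ ‖ξ‖ ^ 2 * (1 - ‖W‖ ^ 2) + ⟪W, ξ⟫ ^ 2 :=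
    le_add_of_nonneg_left (by positivity)
  have hF0 : 0 ≤ F :=
    hF ▸ div_nonneg (sub_nonneg.2 ((le_abs_self _).trans (Real.abs_le_sqrt hle))) hd.le
  have hS := Real.sq_sqrt ((sq_nonneg _).trans hle)
  have hFS : Real.sqrt (‖ξ‖ ^ 2 * (1 - ‖W‖ ^ 2) + ⟪W, ξ⟫ ^ 2) =
      F * (1 - ‖W‖ ^ 2) + ⟪W, ξ⟫ := by
    rw [hF, div_mul_cancel₀ _ hd.ne', sub_add_cancel]
  rw [hFS] at hS
  have hquad : F ^ 2 * (1 - ‖W‖ ^ 2) + 2 * F * ⟪W, ξ⟫ = ‖ξ‖ ^ 2 :=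
    mul_right_cancel₀ hd.ne' (by linear_combination hS)
  refine (sq_eq_sq₀ (norm_nonneg _) hF0).1 ?_
  rw [norm_sub_sq_real, real_inner_smul_right, norm_smul, mul_pow, Real.norm_eq_abs, sq_abs,
    real_inner_comm]
  linear_combination -hquad

/-- Katok–Ziller metrics in coordinates (fiberwise): the dual norm of the Minkowski
co-norm `H_ε(p) = ‖p‖ + ε·⟪p, V⟫` (for `|ε|·‖V‖ < 1`) is given explicitly by
`F_ε(ξ) = (√(‖ξ‖²(1 − ε²‖V‖²) + ε²⟪V, ξ⟫²) − ε⟪V, ξ⟫)/(1 − ε²‖V‖²)`. -/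
theorem katokZiller_dual_norm_formula {E : Type*} [NormedAddCommGroup E]
    [InnerProductSpace ℝ E] (V : E) (ε : ℝ) (h : |ε| * ‖V‖ < 1) (ξ : E) :
    sSup {x : ℝ | ∃ p : E, ‖p‖ + ε * ⟪p, V⟫ = 1 ∧ x = ⟪p, ξ⟫} =
      (Real.sqrt (‖ξ‖ ^ 2 * (1 - ε ^ 2 * ‖V‖ ^ 2) + ε ^ 2 * ⟪V, ξ⟫ ^ 2) - ε * ⟪V, ξ⟫) /
        (1 - ε ^ 2 * ‖V‖ ^ 2) := by
  have hW : ‖ε • V‖ < 1 := by rwa [norm_smul, Real.norm_eq_abs]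
  have key := sSup_inner_eq_of_norm_sub_smul_eq hW (norm_sub_smul_eq_of_norm_lt_one hW ξ rfl)
  simpa only [norm_smul, mul_pow, Real.norm_eq_abs, sq_abs, real_inner_smul_left,
    real_inner_smul_right] using key
end

section
/- Let E be a complete real inner product space, V ∈ E and ε ∈ ℝ. For every p ∈ E with p ≠ 0, the gradient at p of the function q ↦ (‖q‖ + ε·⟨q, V⟩)²/2 equals (1 + ε·⟨p, V⟩/‖p‖) • ( p + (ε·‖p‖) • V ). -/
open scoped RealInnerProductSpace

/-- Away from the origin, the gradient of the norm is the unit radial vector. -/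
theorem hasGradientAt_norm {E : Type*} [NormedAddCommGroup E] [InnerProductSpace ℝ E]
    [CompleteSpace E] {p : E} (hp : p ≠ 0) :
    HasGradientAt (fun q : E => ‖q‖) (‖p‖⁻¹ • p) p := by
  have hp' : ‖p‖ ≠ 0 := norm_ne_zero_iff.mpr hp
  have h := (hasStrictFDerivAt_norm_sq p).hasFDerivAt.sqrt (pow_ne_zero 2 hp')
  simp only [Real.sqrt_sq (norm_nonneg _)] at h
  rw [hasGradientAt_iff_hasFDerivAt]
  refine h.congr_fderiv ?_
  ext v
  simp
  field_simp

/-- Legendre transform of the Katok–Ziller Hamiltonian `H_ε(q) = ‖q‖ + ε·⟪q, V⟫`: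
for `p ≠ 0`, the gradient of `q ↦ H_ε(q)²/2` at `p` is
`(1 + ε·⟪p, V⟫/‖p‖) • (p + (ε·‖p‖) • V)`. -/
theorem katokZiller_legendre_gradient {E : Type*} [NormedAddCommGroup E]
    [InnerProductSpace ℝ E] [CompleteSpace E] (V : E) (ε : ℝ) (p : E) (hp : p ≠ 0) :
    gradient (fun q : E => (‖q‖ + ε * ⟪q, V⟫) ^ 2 / 2) p =
      (1 + ε * ⟪p, V⟫ / ‖p‖) • (p + (ε * ‖p‖) • V) := by
  have hp' : ‖p‖ ≠ 0 := norm_ne_zero_iff.mpr hp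
  have hnorm := (hasGradientAt_norm hp).hasFDerivAt
  have hinner : HasFDerivAt (fun q : E => ⟪q, V⟫) (innerSL ℝ V) p :=
    (innerSL ℝ V).hasFDerivAt.congr_of_eventuallyEq (.of_forall fun q => real_inner_comm V q)
  have h := ((hnorm.add (hinner.const_mul ε)).pow 2).mul_const (2⁻¹ : ℝ)
  refine HasGradientAt.gradient (hasGradientAt_iff_hasFDerivAt.mpr ?_)
  simp only [div_eq_mul_inv _ (2 : ℝ)]
  refine h.congr_fderiv ?_
  ext v
  simp
  field_simp
end

section
/- Let ε ∈ (−1,1) and set A = 2(1−ε²)^{3/2}/(1+√(1−ε²)) and B = 2(1−ε²)/(1+√(1−ε²)). A real number λ is an eigenvalue of −Δ^{F_ε} on the torus ℝ²/ℤ² — that is, there exists a smooth function f : ℝ² → ℂ, not identically zero, satisfying f(x+1,y) = f(x,y) = f(x,y+1) for all (x,y) and A·∂²f/∂x² + B·∂²f/∂y² + λ·f = 0 on ℝ² — if and only if there exist integers p, q with λ = 4π²·(2(1−ε²)/(1+√(1−ε²)))·(√(1−ε²)·p² + q²). -/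
open Real

/-- A continuous `1`-periodic function all of whose Fourier coefficients vanish is zero. -/
lemma eq_zero_of_fourier_integrals_eq_zero {g : ℝ → ℂ} (hg : Continuous g)
    (hp : Function.Periodic g 1)
    (h : ∀ n : ℤ, ∫ x in (0 : ℝ)..1, g x * Complex.exp (-(2 * π * n * x) * Complex.I) = 0)
    (x : ℝ) : g x = 0 := by
  have hc : Continuous (hp.lift : AddCircle (1 : ℝ) → ℂ) := by
    exact continuous_quot_lift _ hg
  let G : C(AddCircle (1 : ℝ), ℂ) := ⟨hp.lift, hc⟩
  have h0 : fourierCoeff (G : AddCircle (1 : ℝ) → ℂ) = 0 := by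
    funext n
    rw [fourierCoeff_eq_intervalIntegral _ n 0]
    have := h n
    simp only [zero_add, div_one, one_smul, Pi.zero_apply]
    rw [← this]
    refine intervalIntegral.integral_congr fun t _ => ?_
    simp only [fourier_coe_apply, smul_eq_mul]
    rw [mul_comm]
    change g t * _ = _
    congr 2
    push_cast
    ring
  have hs := has_pointwise_sum_fourier_series_of_summable (f := G)
    (by rw [h0]; exact summable_zero) (x : AddCircle (1 : ℝ))
  rw [h0] at hs
  simp only [Pi.zero_apply, zero_smul] at hs
  exact hs.unique hasSum_zero

lemma hasDerivAt_exp_linear (a : ℂ) (x : ℝ) :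
    HasDerivAt (fun t : ℝ => Complex.exp (a * t)) (a * Complex.exp (a * x)) x := by
  have h := ((hasDerivAt_id (x : ℂ)).const_mul a).cexp.comp_ofReal
  simpa [mul_comm] using h

lemma deriv_deriv_exp_linear (a : ℂ) (x : ℝ) :
    deriv (deriv fun t : ℝ => Complex.exp (a * t)) x = a ^ 2 * Complex.exp (a * x) := by
  have h : (deriv fun t : ℝ => Complex.exp (a * t)) = fun t : ℝ => a * Complex.exp (a * t) :=
    funext fun t => (hasDerivAt_exp_linear a t).deriv
  rw [h, ((hasDerivAt_exp_linear a x).const_mul a).deriv]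
  ring

/-- Fourier coefficients of the second derivative of a periodic function. -/
lemma integral_deriv_deriv_mul_exp {h : ℝ → ℂ} (hh : ContDiff ℝ 2 h)
    (hp : Function.Periodic h 1) (n : ℤ) :
    ∫ x in (0 : ℝ)..1, deriv (deriv h) x * Complex.exp (-(2 * π * n * x) * Complex.I) =
      -(4 * π ^ 2 * n ^ 2) *
        ∫ x in (0 : ℝ)..1, h x * Complex.exp (-(2 * π * n * x) * Complex.I) := by
  set a : ℂ := -(2 * π * n) * Complex.I with ha
  have he : ∀ x : ℝ, Complex.exp (-(2 * π * n * x) * Complex.I) = Complex.exp (a * x) := by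
    intro x; rw [ha]; congr 1; ring
  have ha2 : a ^ 2 = -(4 * π ^ 2 * n ^ 2) := by
    rw [ha, mul_pow, Complex.I_sq]; ring
  have ha1 : Complex.exp a = 1 := by
    rw [Complex.exp_eq_one_iff]
    exact ⟨-n, by rw [ha]; push_cast; ring⟩
  simp_rw [he]
  rw [← ha2]
  have h1 : ContDiff ℝ 1 (deriv h) := by
    have : ContDiff ℝ (1 + 1) h := by simpa [one_add_one_eq_two] using hh
    exact (contDiff_succ_iff_deriv.1 this).2.2
  have hd : ∀ x, HasDerivAt h (deriv h x) x := fun x =>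
    (hh.differentiable (by norm_num) x).hasDerivAt
  have hdd : ∀ x, HasDerivAt (deriv h) (deriv (deriv h) x) x := fun x =>
    (h1.differentiable (by norm_num) x).hasDerivAt
  have hc2 : Continuous (deriv (deriv h)) := h1.continuous_deriv (by norm_num)
  have hc0 : Continuous h := hh.continuous
  have hper : deriv h 1 = deriv h 0 := by
    have := deriv_comp_add_const h 1 0
    rw [zero_add] at this
    rw [← this]
    congr 1
    exact funext hp
  have hper0 : h 1 = h 0 := by simpa using hp 0
  have key := intervalIntegral.integral_eq_sub_of_hasDerivAt (a := (0 : ℝ)) (b := 1)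
    (f := fun x : ℝ => deriv h x * Complex.exp (a * x) - h x * (a * Complex.exp (a * x)))
    (f' := fun x : ℝ => deriv (deriv h) x * Complex.exp (a * x) -
      a ^ 2 * (h x * Complex.exp (a * x)))
    (fun x _ => by
      have := ((hdd x).mul (hasDerivAt_exp_linear a x)).sub
        ((hd x).mul ((hasDerivAt_exp_linear a x).const_mul a))
      refine this.congr_deriv ?_
      ring)
    (Continuous.intervalIntegrable (by fun_prop) _ _)
  rw [intervalIntegral.integral_sub (Continuous.intervalIntegrable (by fun_prop) _ _)
    (Continuous.intervalIntegrable (by fun_prop) _ _),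
    intervalIntegral.integral_const_mul] at key
  simp only [Complex.ofReal_one, mul_one, ha1, Complex.ofReal_zero, mul_zero, Complex.exp_zero,
    hper, hper0, sub_self] at key
  exact sub_eq_zero.1 key

/-- The first partial derivative of a smooth function of two variables is smooth. -/
lemma contDiff_deriv_fst {f : ℝ → ℝ → ℂ}
    (hf : ContDiff ℝ (⊤ : ℕ∞) fun p : ℝ × ℝ => f p.1 p.2) :
    ContDiff ℝ (⊤ : ℕ∞) fun p : ℝ × ℝ => deriv (fun u => f u p.2) p.1 := by
  have h : (fun p : ℝ × ℝ => deriv (fun u => f u p.2) p.1) =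
      fun p => fderiv ℝ (fun p : ℝ × ℝ => f p.1 p.2) p (1, 0) := by
    funext p
    have h1 := (hf.differentiable (by simp) p).hasFDerivAt
    have h2 : HasDerivAt (fun u : ℝ => (u, p.2)) ((1 : ℝ), (0 : ℝ)) p.1 :=
      (hasDerivAt_id p.1).prodMk (hasDerivAt_const _ _)
    exact (h1.comp_hasDerivAt (f := fun u : ℝ => (u, p.2)) p.1 h2).deriv
  rw [h]
  exact (hf.fderiv_right (m := (⊤ : ℕ∞)) (by simp)).clm_apply contDiff_const

lemma contDiff_deriv_deriv_fst {f : ℝ → ℝ → ℂ}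
    (hf : ContDiff ℝ (⊤ : ℕ∞) fun p : ℝ × ℝ => f p.1 p.2) :
    ContDiff ℝ (⊤ : ℕ∞) fun p : ℝ × ℝ => deriv (deriv fun u => f u p.2) p.1 :=
  contDiff_deriv_fst (f := fun x y => deriv (fun u => f u y) x) (contDiff_deriv_fst hf)

lemma contDiff_deriv_deriv_snd {f : ℝ → ℝ → ℂ}
    (hf : ContDiff ℝ (⊤ : ℕ∞) fun p : ℝ × ℝ => f p.1 p.2) :
    ContDiff ℝ (⊤ : ℕ∞) fun p : ℝ × ℝ => deriv (deriv fun v => f p.1 v) p.2 :=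
  (contDiff_deriv_deriv_fst (f := fun y x => f x y)
    (hf.comp (contDiff_snd.prodMk contDiff_fst))).comp (contDiff_snd.prodMk contDiff_fst)

/-- If a nonzero smooth `ℤ²`-periodic function satisfies `A f_xx + B f_yy + λ f = 0`, then `λ` is
the value of the symbol of the operator at some integer frequency. -/
lemma exists_frequency_of_eigenfunction {A B lam : ℝ} {f : ℝ → ℝ → ℂ}
    (hf : ContDiff ℝ (⊤ : ℕ∞) fun p : ℝ × ℝ => f p.1 p.2)
    (hne : ∃ x y, f x y ≠ 0)
    (hper : ∀ x y, f (x + 1) y = f x y ∧ f x (y + 1) = f x y)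
    (heq : ∀ x y, (A : ℂ) * deriv (deriv fun u => f u y) x +
      (B : ℂ) * deriv (deriv fun v => f x v) y + (lam : ℂ) * f x y = 0) :
    ∃ p q : ℤ, lam = 4 * π ^ 2 * (A * (p : ℝ) ^ 2 + B * (q : ℝ) ^ 2) := by
  let e : ℤ → ℝ → ℂ := fun n x => Complex.exp (-(2 * π * n * x) * Complex.I)
  have hec : ∀ n, Continuous (e n) := fun n => by fun_prop
  have hfx : ∀ y, ContDiff ℝ (⊤ : ℕ∞) fun x => f x y := fun y =>
    hf.comp (contDiff_id.prodMk contDiff_const)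
  have hfy : ∀ x, ContDiff ℝ (⊤ : ℕ∞) fun y => f x y := fun x =>
    hf.comp (contDiff_const.prodMk contDiff_id)
  have h2 : (2 : WithTop ℕ∞) ≤ ((⊤ : ℕ∞) : WithTop ℕ∞) :=
    WithTop.coe_le_coe.2 (le_top : (2 : ℕ∞) ≤ ⊤)
  obtain ⟨x₀, y₀, h0⟩ := hne
  have hcont : Continuous fun p : ℝ × ℝ => f p.1 p.2 := hf.continuous
  have hxx : Continuous fun p : ℝ × ℝ => deriv (deriv fun u => f u p.2) p.1 :=
    (contDiff_deriv_deriv_fst hf).continuous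
  have hyy : Continuous fun p : ℝ × ℝ => deriv (deriv fun v => f p.1 v) p.2 :=
    (contDiff_deriv_deriv_snd hf).continuous
  obtain ⟨p, hp⟩ : ∃ p : ℤ, ∫ x in (0 : ℝ)..1, f x y₀ * e p x ≠ 0 := by
    by_contra! hcon
    exact h0 (eq_zero_of_fourier_integrals_eq_zero (hfx y₀).continuous
      (fun x => (hper x y₀).1) hcon x₀)
  have hcoef : ∀ {F : ℝ → ℝ → ℂ}, (Continuous fun p : ℝ × ℝ => F p.1 p.2) →
      Continuous fun y => ∫ x in (0 : ℝ)..1, F x y * e p x := by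
    intro F hF
    refine intervalIntegral.continuous_parametric_intervalIntegral_of_continuous'
      (f := fun y x => F x y * e p x) ?_ 0 1
    exact (hF.comp (continuous_snd.prodMk continuous_fst)).mul ((hec p).comp continuous_snd)
  obtain ⟨q, hq⟩ : ∃ q : ℤ, ∫ y in (0 : ℝ)..1, (∫ x in (0 : ℝ)..1, f x y * e p x) * e q y ≠ 0 := by
    by_contra! hcon
    refine hp (eq_zero_of_fourier_integrals_eq_zero (hcoef hcont) (fun y => ?_) hcon y₀)
    exact intervalIntegral.integral_congr fun x _ => by simp only [(hper x y).2]
  refine ⟨p, q, ?_⟩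
  have hX : ∫ y in (0 : ℝ)..1, (∫ x in (0 : ℝ)..1, deriv (deriv fun u => f u y) x * e p x) * e q y
      = -(4 * π ^ 2 * p ^ 2) *
        ∫ y in (0 : ℝ)..1, (∫ x in (0 : ℝ)..1, f x y * e p x) * e q y := by
    rw [← intervalIntegral.integral_const_mul]
    refine intervalIntegral.integral_congr fun y _ => ?_
    simp only [e]
    rw [integral_deriv_deriv_mul_exp ((hfx y).of_le h2) (fun x => (hper x y).1) p]
    ring
  have hswap : ∀ {F : ℝ → ℝ → ℂ}, (Continuous fun p : ℝ × ℝ => F p.1 p.2) →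
      ∫ y in (0 : ℝ)..1, (∫ x in (0 : ℝ)..1, F x y * e p x) * e q y =
        ∫ x in (0 : ℝ)..1, (∫ y in (0 : ℝ)..1, F x y * e q y) * e p x := by
    intro F hF
    simp_rw [← intervalIntegral.integral_mul_const]
    rw [MeasureTheory.intervalIntegral_intervalIntegral_swap]
    · refine intervalIntegral.integral_congr fun x _ =>
        intervalIntegral.integral_congr fun y _ => ?_
      ring
    · have hc : Continuous (fun y x => F x y * e p x * e q y).uncurry :=
        ((hF.comp (continuous_snd.prodMk continuous_fst)).mul
          ((hec p).comp continuous_snd)).mul ((hec q).comp continuous_fst)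
      exact (hc.continuousOn.integrableOn_compact
        (isCompact_uIcc.prod isCompact_uIcc)).mono_set
          (Set.prod_mono Set.uIoc_subset_uIcc Set.uIoc_subset_uIcc)
  have hY : ∫ y in (0 : ℝ)..1, (∫ x in (0 : ℝ)..1, deriv (deriv fun v => f x v) y * e p x) * e q y
      = -(4 * π ^ 2 * q ^ 2) *
        ∫ y in (0 : ℝ)..1, (∫ x in (0 : ℝ)..1, f x y * e p x) * e q y := by
    rw [hswap (F := fun x y => deriv (deriv fun v => f x v) y) hyy, hswap hcont,
      ← intervalIntegral.integral_const_mul]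
    refine intervalIntegral.integral_congr fun x _ => ?_
    simp only [e]
    rw [integral_deriv_deriv_mul_exp ((hfy x).of_le h2) (fun y => (hper x y).2) q]
    ring
  have hlam : ∀ y, (lam : ℂ) * ∫ x in (0 : ℝ)..1, f x y * e p x =
      -(A * ∫ x in (0 : ℝ)..1, deriv (deriv fun u => f u y) x * e p x) -
        B * ∫ x in (0 : ℝ)..1, deriv (deriv fun v => f x v) y * e p x := by
    intro y
    have c1 : Continuous fun x => deriv (deriv fun u => f u y) x :=
      hxx.comp (continuous_id.prodMk continuous_const)
    have c2 : Continuous fun x => deriv (deriv fun v => f x v) y :=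
      hyy.comp (continuous_id.prodMk continuous_const)
    simp_rw [← intervalIntegral.integral_const_mul]
    rw [← intervalIntegral.integral_neg, ← intervalIntegral.integral_sub
      (Continuous.intervalIntegrable (by fun_prop) _ _)
      (Continuous.intervalIntegrable (by fun_prop) _ _)]
    refine intervalIntegral.integral_congr fun x _ => ?_
    linear_combination e p x * heq x y
  have htot : (lam : ℂ) * ∫ y in (0 : ℝ)..1, (∫ x in (0 : ℝ)..1, f x y * e p x) * e q y =
      -(A * ∫ y in (0 : ℝ)..1,
          (∫ x in (0 : ℝ)..1, deriv (deriv fun u => f u y) x * e p x) * e q y) -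
        B * ∫ y in (0 : ℝ)..1,
          (∫ x in (0 : ℝ)..1, deriv (deriv fun v => f x v) y * e p x) * e q y := by
    have c1 := hcoef (F := fun x y => deriv (deriv fun u => f u y) x) hxx
    have c2 := hcoef (F := fun x y => deriv (deriv fun v => f x v) y) hyy
    rw [← intervalIntegral.integral_const_mul, ← intervalIntegral.integral_const_mul (A : ℂ),
      ← intervalIntegral.integral_const_mul (B : ℂ), ← intervalIntegral.integral_neg,
      ← intervalIntegral.integral_sub
      (Continuous.intervalIntegrable (by fun_prop) _ _)
      (Continuous.intervalIntegrable (by fun_prop) _ _)]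
    refine intervalIntegral.integral_congr fun y _ => ?_
    linear_combination e q y * hlam y
  rw [hX, hY] at htot
  have hfin : (lam : ℂ) = 4 * π ^ 2 * (A * (p : ℂ) ^ 2 + B * (q : ℂ) ^ 2) := by
    refine mul_right_cancel₀ hq ?_
    rw [htot]
    ring
  exact_mod_cast hfin



/-- Spectrum of the Finsler–Laplace operator of the Katok–Ziller metric on the torus
`ℝ²/ℤ²`: with `A = 2(1−ε²)^{3/2}/(1+√(1−ε²))` and `B = 2(1−ε²)/(1+√(1−ε²))`, a real
number `λ` is an eigenvalue of `−Δ^{F_ε}` (i.e. there is a nonzero smooth ℤ²-periodic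
function `f` with `A·f_xx + B·f_yy + λ·f = 0`) if and only if
`λ = 4π²·(2(1−ε²)/(1+√(1−ε²)))·(√(1−ε²)·p² + q²)` for some integers `p`, `q`. -/
theorem katokZiller_torus_spectrum (ε : ℝ) (hε : ε ∈ Set.Ioo (-1 : ℝ) 1) (lam : ℝ) :
    (∃ f : ℝ → ℝ → ℂ,
      ContDiff ℝ (⊤ : ℕ∞) (fun p : ℝ × ℝ => f p.1 p.2) ∧
      (∃ x y, f x y ≠ 0) ∧
      (∀ x y, f (x + 1) y = f x y ∧ f x (y + 1) = f x y) ∧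
      (∀ x y,
        ((2 * (1 - ε ^ 2) * Real.sqrt (1 - ε ^ 2) / (1 + Real.sqrt (1 - ε ^ 2)) : ℝ) : ℂ) *
            deriv (deriv fun u => f u y) x +
          ((2 * (1 - ε ^ 2) / (1 + Real.sqrt (1 - ε ^ 2)) : ℝ) : ℂ) *
            deriv (deriv fun v => f x v) y +
          (lam : ℂ) * f x y = 0)) ↔
    ∃ p q : ℤ, lam = 4 * π ^ 2 * (2 * (1 - ε ^ 2) / (1 + Real.sqrt (1 - ε ^ 2))) *
      (Real.sqrt (1 - ε ^ 2) * (p : ℝ) ^ 2 + (q : ℝ) ^ 2) := by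
  constructor
  · rintro ⟨f, hf, hne, hper, heq⟩
    obtain ⟨p, q, h⟩ := exists_frequency_of_eigenfunction hf hne hper heq
    exact ⟨p, q, by rw [h]; ring⟩
  · rintro ⟨p, q, rfl⟩
    let a : ℤ → ℂ := fun n => 2 * π * n * Complex.I
    have ha1 : ∀ n, Complex.exp (a n) = 1 := fun n =>
      Complex.exp_eq_one_iff.2 ⟨n, by simp only [a]; ring⟩
    have ha2 : ∀ n, a n ^ 2 = -(4 * π ^ 2 * n ^ 2) := fun n => by
      simp only [a]; rw [mul_pow, Complex.I_sq]; ring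
    refine ⟨fun x y => Complex.exp (a p * x) * Complex.exp (a q * y), ?_, ⟨0, 0, by simp⟩,
      fun x y => ⟨?_, ?_⟩, fun x y => ?_⟩
    · have h : ContDiff ℝ (⊤ : ℕ∞) fun t : ℝ => (t : ℂ) := Complex.ofRealCLM.contDiff
      exact (contDiff_const.mul (h.comp contDiff_fst)).cexp.mul
        (contDiff_const.mul (h.comp contDiff_snd)).cexp
    · simp [mul_add, Complex.exp_add, ha1]
    · simp [mul_add, Complex.exp_add, ha1]
    · have hx : deriv (deriv fun u : ℝ => Complex.exp (a p * u) * Complex.exp (a q * y)) x =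
          a p ^ 2 * (Complex.exp (a p * x) * Complex.exp (a q * y)) := by
        simp only [deriv_mul_const_field']
        rw [deriv_deriv_exp_linear, mul_assoc]
      have hy : deriv (deriv fun v : ℝ => Complex.exp (a p * x) * Complex.exp (a q * v)) y =
          a q ^ 2 * (Complex.exp (a p * x) * Complex.exp (a q * y)) := by
        simp only [deriv_const_mul_field']
        rw [deriv_deriv_exp_linear]
        ring
      rw [hx, hy, ha2, ha2]
      push_cast
      ring
end

section
/- Let ε ∈ (−1,1) and define u : (0,π) × ℝ → ℂ by u(φ,θ) = e^{iθ}·sin φ. Then for all φ ∈ (0,π) and θ ∈ ℝ: (2/(1+√(1−ε²sin²φ)))·[ ((1−ε²sin²φ)^{3/2}/sin²φ)·∂²u/∂θ²(φ,θ) + (1−ε²sin²φ)·∂²u/∂φ²(φ,θ) + (cos φ/sin φ)·(ε²sin²φ + √(1−ε²sin²φ))·∂u/∂φ(φ,θ) ] = −(2 − 2ε²)·u(φ,θ). -/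
open Real

/-- The scalar identity behind the eigenvalue equation, with `s = sin φ`, `c = cos φ`
and `r = √(1 - ε² sin² φ)`. -/
lemma katokZiller_scalar_identity {ε s c r : ℝ} (hs : s ≠ 0) (hr : 1 + r ≠ 0)
    (hrs : r ^ 2 = 1 - ε ^ 2 * s ^ 2) (hcs : c ^ 2 = 1 - s ^ 2) :
    2 / (1 + r) * (r ^ 3 / s ^ 2 * -s + (1 - ε ^ 2 * s ^ 2) * -s +
      c / s * (ε ^ 2 * s ^ 2 + r) * c) = -(2 - 2 * ε ^ 2) * s := by
  have hε : ε ^ 2 * s ^ 2 = 1 - r ^ 2 := by linarith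
  rw [hε]
  field_simp
  linear_combination (1 - r ^ 2 + r) * hcs - (1 + r) * hε

lemma deriv_cexp_I_mul_mul_const (a : ℂ) :
    deriv (fun t : ℝ => Complex.exp (Complex.I * t) * a) =
      fun t : ℝ => Complex.exp (Complex.I * t) * (Complex.I * a) := by
  funext t
  have h : HasDerivAt (fun t : ℝ => Complex.I * (t : ℂ)) (Complex.I * 1) t :=
    (Complex.ofRealCLM.hasDerivAt (x := t)).const_mul Complex.I
  rw [(h.cexp.mul_const a).deriv]
  ring

lemma deriv_const_mul_ofReal_sin (a : ℂ) :
    deriv (fun t : ℝ => a * (Real.sin t : ℂ)) = fun t : ℝ => a * (Real.cos t : ℂ) := by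
  funext t
  exact ((Real.hasDerivAt_sin t).ofReal_comp.const_mul a).deriv

lemma deriv_const_mul_ofReal_cos (a : ℂ) :
    deriv (fun t : ℝ => a * (Real.cos t : ℂ)) =
      fun t : ℝ => a * ((-Real.sin t : ℝ) : ℂ) := by
  funext t
  exact ((Real.hasDerivAt_cos t).ofReal_comp.const_mul a).deriv

/-- The spherical harmonic `Y₁¹(φ,θ) = e^{iθ}·sin φ` is an eigenfunction of the
Finsler–Laplace operator of the Katok–Ziller metric on the 2-sphere, with
eigenvalue `2 − 2ε²`: for all `φ ∈ (0,π)` and `θ ∈ ℝ`,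
`Δ^{F_ε} u (φ,θ) = −(2 − 2ε²)·u(φ,θ)`. -/
theorem katokZiller_sphere_Y11_eigenfunction (ε : ℝ) (hε : ε ∈ Set.Ioo (-1 : ℝ) 1)
    (u : ℝ → ℝ → ℂ)
    (hu : ∀ φ θ : ℝ, u φ θ = Complex.exp (Complex.I * θ) * (Real.sin φ : ℂ))
    (φ θ : ℝ) (hφ : φ ∈ Set.Ioo 0 π) :
    ((2 / (1 + Real.sqrt (1 - ε ^ 2 * Real.sin φ ^ 2)) : ℝ) : ℂ) *
      (((Real.sqrt (1 - ε ^ 2 * Real.sin φ ^ 2) ^ 3 / Real.sin φ ^ 2 : ℝ) : ℂ) *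
          deriv (deriv (u φ)) θ +
        ((1 - ε ^ 2 * Real.sin φ ^ 2 : ℝ) : ℂ) *
          deriv (deriv fun s => u s θ) φ +
        ((Real.cos φ / Real.sin φ *
            (ε ^ 2 * Real.sin φ ^ 2 + Real.sqrt (1 - ε ^ 2 * Real.sin φ ^ 2)) : ℝ) : ℂ) *
          deriv (fun s => u s θ) φ) =
      -((2 - 2 * ε ^ 2 : ℝ) : ℂ) * u φ θ := by
  have hs : 0 < Real.sin φ := Real.sin_pos_of_pos_of_lt_pi hφ.1 hφ.2
  have hnonneg : 0 ≤ 1 - ε ^ 2 * Real.sin φ ^ 2 := by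
    have h₁ : ε ^ 2 ≤ 1 := by nlinarith [hε.1, hε.2]
    nlinarith [Real.sin_sq_le_one φ, sq_nonneg (Real.sin φ), sq_nonneg ε]
  have key := katokZiller_scalar_identity hs.ne'
    (by positivity : 1 + √(1 - ε ^ 2 * Real.sin φ ^ 2) ≠ 0)
    (Real.sq_sqrt hnonneg) (Real.cos_sq' φ)
  obtain rfl : u = fun φ θ : ℝ => Complex.exp (Complex.I * θ) * (Real.sin φ : ℂ) := by
    funext φ θ
    exact hu φ θ
  simp only [deriv_cexp_I_mul_mul_const, deriv_const_mul_ofReal_sin,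
    deriv_const_mul_ofReal_cos]
  have keyC := congrArg (Complex.ofReal) key
  rw [← mul_assoc Complex.I, Complex.I_mul_I]
  simp only [Complex.ofReal_mul, Complex.ofReal_add, Complex.ofReal_neg] at keyC ⊢
  linear_combination Complex.exp (Complex.I * θ) * keyC
end

section
/- Let E be a finite-dimensional real normed vector space and let F : E → ℝ be a smooth strongly convex Minkowski norm: F is continuous on E with F(0) = 0 and F(v) > 0 for v ≠ 0, F(c·v) = c·F(v) for all c > 0, F is C^∞ on E ∖ {0}, and the second derivative (Hessian) of F² at every v ≠ 0 is positive definite, i.e. D²(F²)(v)[w,w] > 0 for every w ≠ 0. Then the Legendre transform L_F : v ↦ D(F²/2)(v) is a bijection from E ∖ {0} onto E* ∖ {0} (the set of nonzero continuous linear functionals on E). -/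
section MinkowskiNorm

variable {E : Type*} [NormedAddCommGroup E] [NormedSpace ℝ E] {F : E → ℝ}

/-- Euler's identity for the square of a positively homogeneous function of degree one. -/
theorem fderiv_sq_apply_self (hhom : ∀ c : ℝ, 0 < c → ∀ v : E, F (c • v) = c * F v) {v : E}
    (hd : DifferentiableAt ℝ (fun u => F u ^ 2) v) :
    fderiv ℝ (fun u => F u ^ 2) v v = 2 * F v ^ 2 := by
  have hline : HasDerivAt (fun t : ℝ => t • v) v 1 := by
    simpa using (hasDerivAt_id (1 : ℝ)).smul_const v
  have hcomp : HasDerivAt (fun t : ℝ => F (t • v) ^ 2) (fderiv ℝ (fun u => F u ^ 2) v v) 1 := by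
    have hd' : HasFDerivAt (fun u => F u ^ 2) (fderiv ℝ (fun u => F u ^ 2) v) ((1 : ℝ) • v) := by
      simpa using hd.hasFDerivAt
    exact hd'.comp_hasDerivAt (1 : ℝ) hline
  have hquad : HasDerivAt (fun t : ℝ => t ^ 2 * F v ^ 2) (2 * F v ^ 2) 1 := by
    simpa using (hasDerivAt_pow 2 (1 : ℝ)).mul_const (F v ^ 2)
  refine hcomp.unique (hquad.congr_of_eventuallyEq ?_)
  filter_upwards [lt_mem_nhds (zero_lt_one (α := ℝ))] with t ht
  rw [hhom t ht, mul_pow]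

/-- A function with positive definite second derivative along a segment has distinct derivatives
at the endpoints. -/
theorem fderiv_ne_of_forall_segment_pos {H : E → ℝ} {v w : E}
    (hd : ∀ u ∈ segment ℝ w v, DifferentiableAt ℝ (fderiv ℝ H) u)
    (hpos : ∀ u ∈ segment ℝ w v, 0 < fderiv ℝ (fderiv ℝ H) u (v - w) (v - w)) :
    fderiv ℝ H v ≠ fderiv ℝ H w := by
  intro heq
  have hmem : ∀ t ∈ Set.Icc (0 : ℝ) 1, w + t • (v - w) ∈ segment ℝ w v := fun t ht => by
    rw [segment_eq_image']
    exact ⟨t, ht, rfl⟩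
  have hder : ∀ t ∈ Set.Icc (0 : ℝ) 1,
      HasDerivAt (fun t : ℝ => fderiv ℝ H (w + t • (v - w)) (v - w))
        (fderiv ℝ (fderiv ℝ H) (w + t • (v - w)) (v - w) (v - w)) t := fun t ht => by
    have hline : HasDerivAt (fun t : ℝ => w + t • (v - w)) (v - w) t := by
      simpa using ((hasDerivAt_id t).smul_const (v - w)).const_add w
    have hcomp := (hd _ (hmem t ht)).hasFDerivAt.comp_hasDerivAt t hline
    simpa using hcomp.clm_apply (hasDerivAt_const t (v - w))
  obtain ⟨t, ht, h⟩ := exists_hasDerivAt_eq_zero zero_lt_one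
    (fun t ht => (hder t ht).continuousAt.continuousWithinAt) (by simp [heq])
    (fun t ht => hder t (Set.Ioo_subset_Icc_self ht))
  exact (hpos _ (hmem t (Set.Ioo_subset_Icc_self ht))).ne' h

variable [FiniteDimensional ℝ E]

/-- A continuous positively homogeneous function that is positive away from the origin dominates
a positive multiple of the norm. -/
theorem exists_pos_mul_norm_le (hcont : Continuous F) (h0 : F 0 = 0)
    (hpos : ∀ v : E, v ≠ 0 → 0 < F v)
    (hhom : ∀ c : ℝ, 0 < c → ∀ v : E, F (c • v) = c * F v) :
    ∃ m : ℝ, 0 < m ∧ ∀ v : E, m * ‖v‖ ≤ F v := by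
  have := FiniteDimensional.proper_real E
  rcases subsingleton_or_nontrivial E with hE | hE
  · exact ⟨1, one_pos, fun v => by simp [Subsingleton.elim v 0, h0]⟩
  obtain ⟨x, hx, hmin⟩ := (isCompact_sphere (0 : E) 1).exists_isMinOn
    (NormedSpace.sphere_nonempty.mpr zero_le_one) hcont.continuousOn
  refine ⟨F x, hpos x (ne_zero_of_mem_unit_sphere ⟨x, hx⟩), fun v => ?_⟩
  rcases eq_or_ne v 0 with rfl | hv
  · simp [h0]
  have hn : 0 < ‖v‖ := norm_pos_iff.mpr hv
  have hle : F x ≤ F (‖v‖⁻¹ • v) := hmin (by simp [norm_smul, hn.ne'])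
  rwa [hhom _ (inv_pos.mpr hn), inv_mul_eq_div, le_div_iff₀ hn] at hle

/-- For a Minkowski norm `F`, the function `F ^ 2 / 2 - p` attains its minimum, and does so away
from the origin when `p ≠ 0`. -/
theorem exists_ne_zero_forall_sq_div_two_sub_le (hcont : Continuous F) (h0 : F 0 = 0)
    (hpos : ∀ v : E, v ≠ 0 → 0 < F v)
    (hhom : ∀ c : ℝ, 0 < c → ∀ v : E, F (c • v) = c * F v) {p : E →L[ℝ] ℝ} (hp : p ≠ 0) :
    ∃ v : E, v ≠ 0 ∧ ∀ u : E, F v ^ 2 / 2 - p v ≤ F u ^ 2 / 2 - p u := by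
  have := FiniteDimensional.proper_real E
  obtain ⟨m, hm, hmF⟩ := exists_pos_mul_norm_le hcont h0 hpos hhom
  have hquad : Filter.Tendsto (fun r : ℝ => r * (m ^ 2 / 2 * r - ‖p‖)) Filter.atTop
      Filter.atTop :=
    Filter.tendsto_id.atTop_mul_atTop₀ (Filter.tendsto_atTop_add_const_right _ _
      (Filter.tendsto_id.const_mul_atTop (by positivity)))
  have hlim : Filter.Tendsto (fun u : E => F u ^ 2 / 2 - p u) (Filter.cocompact E)
      Filter.atTop := by
    refine Filter.tendsto_atTop_mono (fun u => ?_)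
      (hquad.comp (tendsto_norm_cocompact_atTop (E := E)))
    have h1 : (m * ‖u‖) ^ 2 ≤ F u ^ 2 := by
      gcongr
      exact hmF u
    have h2 : p u ≤ ‖p‖ * ‖u‖ := (le_abs_self _).trans (p.le_opNorm u)
    simp only [Function.comp_apply]
    nlinarith
  obtain ⟨v, hv⟩ := Continuous.exists_forall_le
    (f := fun u : E => F u ^ 2 / 2 - p u) (by fun_prop) hlim
  refine ⟨v, ?_, hv⟩
  rintro rfl
  obtain ⟨u, hu⟩ : ∃ u, 0 < p u := by
    obtain ⟨u, hu⟩ := DFunLike.ne_iff.mp hp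
    rcases lt_or_gt_of_ne hu with h | h
    · exact ⟨-u, by simpa using h⟩
    · exact ⟨u, h⟩
  have hFu : 0 < F u := hpos u (by rintro rfl; simp at hu)
  have ht : 0 < p u / F u ^ 2 := by positivity
  have hle := hv ((p u / F u ^ 2) • u)
  simp only [h0, map_zero, map_smul, hhom _ ht, smul_eq_mul] at hle
  have heq : (p u / F u ^ 2 * F u) ^ 2 / 2 - p u / F u ^ 2 * p u = -((p u / F u) ^ 2 / 2) := by
    field_simp
    ring
  have : 0 < (p u / F u) ^ 2 := by positivity
  linarith

end MinkowskiNorm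

/-- The Legendre transform of a smooth strongly convex Minkowski norm is a bijection:
if `F` is a Minkowski norm on a finite-dimensional real vector space `E` which is `C^∞`
away from `0` and whose second derivative `D²(F²)(v)` is positive definite at every
`v ≠ 0`, then `L_F : v ↦ D(F²/2)(v)` is a bijection from `E ∖ {0}` onto `E* ∖ {0}`. -/
theorem legendre_transform_bijective {E : Type*} [NormedAddCommGroup E] [NormedSpace ℝ E]
    [FiniteDimensional ℝ E] (F : E → ℝ)
    (hcont : Continuous F) (h0 : F 0 = 0) (hpos : ∀ v : E, v ≠ 0 → 0 < F v)
    (hhom : ∀ c : ℝ, 0 < c → ∀ v : E, F (c • v) = c * F v)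
    (hsmooth : ContDiffOn ℝ (⊤ : ℕ∞) F {v : E | v ≠ 0})
    (hconv : ∀ v : E, v ≠ 0 → ∀ w : E, w ≠ 0 →
      0 < fderiv ℝ (fderiv ℝ fun u : E => F u ^ 2) v w w) :
    Set.BijOn (fun v : E => fderiv ℝ (fun w : E => F w ^ 2 / 2) v)
      {v : E | v ≠ 0} {p : E →L[ℝ] ℝ | p ≠ 0} := by
  have hopen : IsOpen {v : E | v ≠ 0} := isOpen_ne
  have hcd : ∀ v : E, v ≠ 0 → ContDiffAt ℝ (⊤ : ℕ∞) (fun u => F u ^ 2) v := fun v hv =>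
    (hsmooth.contDiffAt (hopen.mem_nhds hv)).pow 2
  have hd : ∀ v : E, v ≠ 0 → DifferentiableAt ℝ (fun u => F u ^ 2) v := fun v hv =>
    (hcd v hv).differentiableAt (by simp)
  have hd2 : ∀ v : E, v ≠ 0 → DifferentiableAt ℝ (fderiv ℝ fun u => F u ^ 2) v := fun v hv =>
    ((hcd v hv).fderiv_right (m := (1 : ℕ∞))
      (WithTop.coe_le_coe.mpr le_top)).differentiableAt (by simp)
  have hL : ∀ v : E, v ≠ 0 → HasFDerivAt (fun w : E => F w ^ 2 / 2)
      ((2 : ℝ)⁻¹ • fderiv ℝ (fun u => F u ^ 2) v) v := fun v hv => by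
    simpa [div_eq_inv_mul] using (hd v hv).hasFDerivAt.const_mul (2 : ℝ)⁻¹
  have heuler : ∀ v : E, v ≠ 0 → 0 < fderiv ℝ (fun u => F u ^ 2) v v := fun v hv => by
    have := hpos v hv
    rw [fderiv_sq_apply_self hhom (hd v hv)]
    positivity
  refine ⟨fun v hv h => ?_, fun v hv w hw h => ?_, fun p hp => ?_⟩
  · have := heuler v hv
    simp only [(hL v hv).fderiv, smul_eq_zero, inv_eq_zero, OfNat.ofNat_ne_zero, false_or] at h
    simp [h] at this
  · have heq : fderiv ℝ (fun u => F u ^ 2) v = fderiv ℝ (fun u => F u ^ 2) w := by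
      simp only [(hL v hv).fderiv, (hL w hw).fderiv] at h
      exact smul_right_injective _ (inv_ne_zero two_ne_zero) h
    by_contra hvw
    have hseg : ∀ u ∈ segment ℝ w v, u ≠ 0 := by
      rintro _ ⟨a, b, ha, hb, hab, rfl⟩ hu
      have hv' := heuler v hv
      have hw' := heuler w hw
      rw [← heq] at hw'
      have hq := congrArg (fderiv ℝ (fun u => F u ^ 2) v) hu
      simp only [map_add, map_smul, smul_eq_mul, map_zero] at hq
      rcases ha.eq_or_lt with rfl | ha
      · nlinarith
      · nlinarith [mul_pos ha hw', mul_nonneg hb hv'.le]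
    exact fderiv_ne_of_forall_segment_pos (fun u hu => hd2 u (hseg u hu))
      (fun u hu => hconv u (hseg u hu) _ (sub_ne_zero.mpr hvw)) heq
  · obtain ⟨v, hv, hmin⟩ := exists_ne_zero_forall_sq_div_two_sub_le hcont h0 hpos hhom hp
    refine ⟨v, hv, ?_⟩
    have hloc : IsLocalMin (fun u : E => F u ^ 2 / 2 - p u) v := Filter.Eventually.of_forall hmin
    have hzero := hloc.hasFDerivAt_eq_zero ((hL v hv).sub p.hasFDerivAt)
    exact (hL v hv).fderiv.trans (sub_eq_zero.mp hzero)
end
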